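/- arXiv:1510.08863 — 9 statements merged into one kernel-verified Lean document; each statement's English description precedes it below -/
import Mathlib

section
/- For every η with 0 < η < 1, the function μ ↦ s(μ) − s(η/2 + (1 − η) * μ) tends to −log₂(1 − η) as μ → ∞ (limit along Filter.atTop). (This limit is the reverse coherent information of the bosonic lossy channel with transmissivity η, computed from two-mode squeezed vacuum inputs of variance μ; it is the achievable lower bound which matches the paper's upper bound and hence equals the secret-key capacity −log₂(1 − η) of the lossy channel.) -/
noncomputable def log2 (x : ℝ) : ℝ := Real.log x / Real.log 2

/-- Gaussian entropic function `s(ν)`. -/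
noncomputable def sfun (ν : ℝ) : ℝ :=
  (ν + 1/2) * log2 (ν + 1/2) - (ν - 1/2) * log2 (ν - 1/2)

open Filter Topology

/-- The entropic function is asymptotically `log2 ν + 1 / log 2`. -/
theorem tendsto_sfun_sub_log2_atTop :
    Tendsto (fun ν : ℝ => sfun ν - log2 ν) atTop (𝓝 (1 / Real.log 2)) := by
  have mul_log (t : ℝ) : Tendsto (fun ν : ℝ => ν * Real.log (1 + t / ν)) atTop (𝓝 t) :=
    Real.tendsto_mul_log_one_add_div_atTop t
  have log_zero (t : ℝ) : Tendsto (fun ν : ℝ => Real.log (1 + t / ν)) atTop (𝓝 0) := by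
    have h : Tendsto (fun ν : ℝ => 1 + t / ν) atTop (𝓝 (1 + 0)) :=
      tendsto_const_nhds.add (tendsto_const_nhds.div_atTop tendsto_id)
    simpa using h.log (by norm_num)
  have key := ((((mul_log (1 / 2)).sub (mul_log (-(1 / 2)))).add
    (((log_zero (1 / 2)).add (log_zero (-(1 / 2)))).const_mul (1 / 2))).div_const (Real.log 2))
  rw [show ((1 / 2 : ℝ) - -(1 / 2) + 1 / 2 * (0 + 0)) = 1 by norm_num] at key
  refine key.congr' ?_
  filter_upwards [eventually_gt_atTop (1 / 2 : ℝ)] with ν hν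
  have hν0 : 0 < ν := by linarith
  have log_shift (t : ℝ) (ht : 0 < ν + t) :
      Real.log (ν + t) = Real.log ν + Real.log (1 + t / ν) := by
    have hpos : 1 + t / ν = (ν + t) / ν := by field_simp
    rw [hpos, Real.log_div ht.ne' hν0.ne']
    ring
  have hsub := log_shift (-(1 / 2)) (by linarith)
  rw [← sub_eq_add_neg] at hsub
  rw [sfun, log2, log2, log2, log_shift (1 / 2) (by linarith), hsub]
  ring

theorem reverse_coherent_info_lossy_limit (η : ℝ) (hη0 : 0 < η) (hη1 : η < 1) :
    Filter.Tendsto (fun μ : ℝ => sfun μ - sfun (η/2 + (1 - η) * μ))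
      Filter.atTop (nhds (-(log2 (1 - η)))) := by
  have hη : 0 < 1 - η := by linarith
  have hout : Tendsto (fun μ : ℝ => η / 2 + (1 - η) * μ) atTop atTop :=
    tendsto_atTop_add_const_left _ _ (tendsto_id.const_mul_atTop hη)
  have hratio : Tendsto (fun μ : ℝ => η / 2 / μ + (1 - η)) atTop (𝓝 (0 + (1 - η))) :=
    (tendsto_const_nhds.div_atTop tendsto_id).add tendsto_const_nhds
  rw [zero_add] at hratio
  have key := (tendsto_sfun_sub_log2_atTop.sub (tendsto_sfun_sub_log2_atTop.comp hout)).sub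
    ((hratio.log hη.ne').div_const (Real.log 2))
  rw [sub_self, zero_sub] at key
  refine key.congr' ?_
  filter_upwards [eventually_gt_atTop (0 : ℝ)] with μ hμ
  have hpos : 0 < η / 2 + (1 - η) * μ := by positivity
  have hdiv : η / 2 / μ + (1 - η) = (η / 2 + (1 - η) * μ) / μ := by field_simp
  rw [hdiv, Real.log_div hpos.ne' hμ.ne']
  simp only [Function.comp_apply, log2]
  ring
end

section
/- For every η with 0 < η < 1, h(x) − h((1 − η) * x) → −log₂(1 − η) as x → ∞ (limit along Filter.atTop). (This shows that the energy-constrained reverse coherent information I_RC(m̄, η) = h(m̄) − h((1 − η)·m̄) of the lossy channel with transmissivity η converges to the unconstrained secret-key capacity −log₂(1 − η) as the mean photon number m̄ → ∞.) -/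
/-- Thermal-state entropic function `h(x)` (with `0 * log₂ 0 = 0`). -/
noncomputable def hfun (x : ℝ) : ℝ := (x + 1) * log2 (x + 1) - x * log2 x

open Filter Topology

lemma tendsto_hfun_sub_log2 :
    Tendsto (fun x : ℝ => hfun x - log2 x) atTop (𝓝 (1 / Real.log 2)) := by
  have hmul := Real.tendsto_mul_log_one_add_div_atTop 1
  have hlog : Tendsto (fun x : ℝ => Real.log (1 + 1 / x)) atTop (𝓝 0) := by
    have hinv : Tendsto (fun x : ℝ => 1 + 1 / x) atTop (𝓝 1) := by
      simpa using tendsto_inv_atTop_zero.const_add (1 : ℝ)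
    simpa using hinv.log one_ne_zero
  have hsum := (hmul.add hlog).div_const (Real.log 2)
  rw [add_zero] at hsum
  refine hsum.congr' ?_
  filter_upwards [eventually_gt_atTop 0] with x hx
  have hdiv : 1 + 1 / x = (x + 1) / x := by field_simp
  rw [hdiv, Real.log_div (by positivity) hx.ne']
  simp only [hfun, log2]
  ring

theorem energy_constrained_RCI_limit (η : ℝ) (hη0 : 0 < η) (hη1 : η < 1) :
    Filter.Tendsto (fun x : ℝ => hfun x - hfun ((1 - η) * x))
      Filter.atTop (nhds (-(log2 (1 - η)))) := by
  have hc : 0 < 1 - η := sub_pos.mpr hη1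
  have hscaled := tendsto_hfun_sub_log2.comp (tendsto_id.const_mul_atTop hc)
  have hdiff := (tendsto_hfun_sub_log2.sub hscaled).sub_const (log2 (1 - η))
  rw [sub_self, zero_sub] at hdiff
  refine hdiff.congr' ?_
  filter_upwards [eventually_gt_atTop 0] with x hx
  have hlog : log2 ((1 - η) * x) = log2 (1 - η) + log2 x := by
    simp only [log2, Real.log_mul hc.ne' hx.ne', add_div]
  simp only [Function.comp_apply, id_eq, hlog]
  ring
end

section
/- For every η with 0 < η < 1, Δ(μ) → 2 − Real.log η as μ → ∞ (limit along Filter.atTop). (This is the limit of the cross-term Δ appearing in the Gaussian relative entropy S(ρ_E^μ ‖ σ̃_s^μ) between the quasi-Choi matrix of the lossy channel of transmissivity η and the closest-correlated separable Gaussian state.) -/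
/-- Inverse hyperbolic cotangent. -/
noncomputable def arcoth (x : ℝ) : ℝ := (1/2) * Real.log ((x + 1)/(x - 1))

noncomputable def afun (η μ : ℝ) : ℝ :=
  Real.sqrt (1 - (6 - η)*η + 4*μ*(1 + (4 - η)*η + (1 - η)^2 * μ))

noncomputable def bfun (η μ : ℝ) : ℝ :=
  Real.sqrt (8*μ + (2*μ - 1)*(4*η + (2*μ - 1)*(1 - η)^2))

noncomputable def cfun (η μ : ℝ) : ℝ :=
  2*η*(2*μ - 1)*(2*Real.sqrt (4*μ^2 - 1) - 1 - 2*μ) - η^2*(2*μ - 1)^2 - (1 + 2*μ)^2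

noncomputable def Δfun (η μ : ℝ) : ℝ :=
  ((cfun η μ - (2*μ - 1)*(1 - η)*afun η μ)/(bfun η μ)) *
      arcoth (((1 - η)*(1 - 2*μ) - afun η μ)/2)
    - ((cfun η μ + (2*μ - 1)*(1 - η)*afun η μ)/(bfun η μ)) *
      arcoth (((1 - η)*(1 - 2*μ) + afun η μ)/2)

open Filter Topology

lemma tendsto_sqrt_quadratic_div_self {A : ℝ} (hA : 0 ≤ A) (B C : ℝ) :
    Tendsto (fun x : ℝ => Real.sqrt (A ^ 2 * x ^ 2 + B * x + C) / x) atTop (𝓝 A) := by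
  have hinv : Tendsto (fun x : ℝ => x⁻¹) atTop (𝓝 0) := tendsto_inv_atTop_zero
  have h : Tendsto (fun x : ℝ => Real.sqrt (A ^ 2 + B * x⁻¹ + C * x⁻¹ ^ 2)) atTop
      (𝓝 (Real.sqrt (A ^ 2 + B * 0 + C * 0 ^ 2))) :=
    ((tendsto_const_nhds.add (hinv.const_mul B)).add ((hinv.pow 2).const_mul C)).sqrt
  rw [show A ^ 2 + B * 0 + C * 0 ^ 2 = A ^ 2 by ring, Real.sqrt_sq hA] at h
  refine h.congr' ?_
  filter_upwards [eventually_gt_atTop 0] with x hx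
  rw [show A ^ 2 + B * x⁻¹ + C * x⁻¹ ^ 2 = (A ^ 2 * x ^ 2 + B * x + C) / x ^ 2 by field_simp,
    Real.sqrt_div' _ (sq_nonneg x), Real.sqrt_sq hx.le]

lemma tendsto_sqrt_quadratic_sub_linear {A : ℝ} (hA : 0 < A) (B C : ℝ) :
    Tendsto (fun x : ℝ => Real.sqrt (A ^ 2 * x ^ 2 + B * x + C) - A * x) atTop
      (𝓝 (B / (2 * A))) := by
  have hinv : Tendsto (fun x : ℝ => x⁻¹) atTop (𝓝 0) := tendsto_inv_atTop_zero
  have hdiv := tendsto_sqrt_quadratic_div_self hA.le B C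
  have h : Tendsto (fun x : ℝ => (B + C * x⁻¹) /
      (Real.sqrt (A ^ 2 * x ^ 2 + B * x + C) / x + A)) atTop (𝓝 ((B + C * 0) / (A + A))) :=
    (tendsto_const_nhds.add (hinv.const_mul C)).div (hdiv.add_const A) (by positivity)
  rw [show (B + C * 0) / (A + A) = B / (2 * A) by ring] at h
  refine h.congr' ?_
  filter_upwards [eventually_gt_atTop 0, hdiv.eventually_const_lt hA] with x hx hpos
  have hs : 0 < Real.sqrt (A ^ 2 * x ^ 2 + B * x + C) := by
    have := mul_pos hpos hx
    rwa [div_mul_cancel₀ _ hx.ne'] at this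
  have hsq := Real.sq_sqrt (Real.sqrt_pos.mp hs).le
  set s := Real.sqrt (A ^ 2 * x ^ 2 + B * x + C)
  have hden : s + A * x ≠ 0 := by positivity
  have hden' : s / x + A ≠ 0 := by positivity
  rw [div_eq_iff hden']
  field_simp
  linear_combination -hsq

lemma arcoth_one_sub {z : ℝ} (hz : z ≠ 0) :
    arcoth (1 - z) = 1 / 2 * Real.log (1 + (-2) / z) := by
  rw [arcoth, show (1 - z + 1) / (1 - z - 1) = 1 + (-2) / z by
    rw [show 1 - z - 1 = -z by ring]; field_simp; ring]

lemma tendsto_mul_arcoth_one_sub :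
    Tendsto (fun z : ℝ => z * arcoth (1 - z)) atTop (𝓝 (-1)) := by
  have h := (Real.tendsto_mul_log_one_add_div_atTop (-2)).const_mul (1 / 2)
  rw [show (1 / 2 : ℝ) * -2 = -1 by norm_num] at h
  refine h.congr' ?_
  filter_upwards [eventually_ne_atTop 0] with z hz
  rw [arcoth_one_sub hz]
  ring

lemma afun_eq (η μ : ℝ) : afun η μ = Real.sqrt ((2 * (1 - η)) ^ 2 * μ ^ 2 +
    4 * (1 + (4 - η) * η) * μ + (1 - (6 - η) * η)) := by
  rw [afun]; congr 1; ring

lemma bfun_eq (η μ : ℝ) : bfun η μ = Real.sqrt ((2 * (1 - η)) ^ 2 * μ ^ 2 +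
    (8 + 8 * η - 4 * (1 - η) ^ 2) * μ + ((1 - η) ^ 2 - 4 * η)) := by
  rw [bfun]; congr 1; ring

lemma continuousAt_arcoth {x : ℝ} (h₁ : x - 1 ≠ 0) (h₂ : x + 1 ≠ 0) :
    ContinuousAt arcoth x := by
  unfold arcoth
  have h₃ : (x + 1) / (x - 1) ≠ 0 := div_ne_zero h₂ h₁
  fun_prop (disch := assumption)

theorem delta_limit (η : ℝ) (hη0 : 0 < η) (hη1 : η < 1) :
    Filter.Tendsto (fun μ : ℝ => Δfun η μ)
      Filter.atTop (nhds (2 - Real.log η)) := by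
  have hd : 0 < 1 - η := sub_pos.mpr hη1
  have hA : 0 < 2 * (1 - η) := by positivity
  have hinv : Tendsto (fun x : ℝ => x⁻¹) atTop (𝓝 0) := tendsto_inv_atTop_zero
  have ha : Tendsto (fun μ => afun η μ / μ) atTop (𝓝 (2 * (1 - η))) := by
    simpa only [afun_eq] using tendsto_sqrt_quadratic_div_self hA.le _ _
  have hb : Tendsto (fun μ => bfun η μ / μ) atTop (𝓝 (2 * (1 - η))) := by
    simpa only [bfun_eq] using tendsto_sqrt_quadratic_div_self hA.le _ _
  have he : Tendsto (fun μ => afun η μ - 2 * (1 - η) * μ) atTop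
      (𝓝 (4 * (1 + (4 - η) * η) / (2 * (2 * (1 - η))))) := by
    simpa only [afun_eq] using tendsto_sqrt_quadratic_sub_linear hA _ _
  have hs : Tendsto (fun μ : ℝ => Real.sqrt (4 * μ ^ 2 - 1) - 2 * μ) atTop (𝓝 0) := by
    have h := tendsto_sqrt_quadratic_sub_linear (zero_lt_two : (0 : ℝ) < 2) 0 (-1)
    norm_num at h
    simpa only [sub_eq_add_neg] using h
  -- The quadratic parts of `cfun` and `(2μ - 1)(1 - η) afun` cancel.
  have hsum : Tendsto (fun μ => (cfun η μ + (2 * μ - 1) * (1 - η) * afun η μ) / μ) atTop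
      (𝓝 (-4 * (1 - η))) := by
    have h : Tendsto (fun μ : ℝ =>
        2 * η * (-4 + μ⁻¹ + 2 * (Real.sqrt (4 * μ ^ 2 - 1) - 2 * μ) * (2 - μ⁻¹))
          - η ^ 2 * (-4 + μ⁻¹) - (4 + μ⁻¹) - 2 * (1 - η) ^ 2
          + (1 - η) * (afun η μ - 2 * (1 - η) * μ) * (2 - μ⁻¹)) atTop
        (𝓝 (2 * η * (-4 + 0 + 2 * 0 * (2 - 0)) - η ^ 2 * (-4 + 0) - (4 + 0) - 2 * (1 - η) ^ 2
          + (1 - η) * (4 * (1 + (4 - η) * η) / (2 * (2 * (1 - η)))) * (2 - 0))) :=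
      ((((((hinv.const_add _).add ((hs.const_mul 2).mul (hinv.const_sub 2))).const_mul _).sub
        ((hinv.const_add _).const_mul _)).sub (hinv.const_add _)).sub_const _).add
        ((he.const_mul _).mul (hinv.const_sub 2))
    have hlim : 2 * η * (-4 + 0 + 2 * 0 * (2 - 0)) - η ^ 2 * (-4 + 0) - (4 + 0) - 2 * (1 - η) ^ 2
        + (1 - η) * (4 * (1 + (4 - η) * η) / (2 * (2 * (1 - η)))) * (2 - 0) = -4 * (1 - η) := by
      field_simp
      ring
    rw [hlim] at h
    refine h.congr' ?_
    filter_upwards [eventually_ne_atTop 0] with μ hμ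
    rw [cfun]
    field_simp
    ring
  have hcoef : Tendsto (fun μ => (2 * μ - 1) * (1 - η) * afun η μ / μ ^ 2) atTop
      (𝓝 (4 * (1 - η) ^ 2)) := by
    have h := (((hinv.const_sub 2).mul_const (1 - η)).mul ha)
    rw [show (2 - 0) * (1 - η) * (2 * (1 - η)) = 4 * (1 - η) ^ 2 by ring] at h
    refine h.congr' ?_
    filter_upwards [eventually_ne_atTop 0] with μ hμ
    field_simp
  have hdiff : Tendsto (fun μ => (cfun η μ - (2 * μ - 1) * (1 - η) * afun η μ) / μ ^ 2) atTop
      (𝓝 (-8 * (1 - η) ^ 2)) := by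
    have h := (hsum.mul hinv).sub (hcoef.const_mul 2)
    rw [show -4 * (1 - η) * 0 - 2 * (4 * (1 - η) ^ 2) = -8 * (1 - η) ^ 2 by ring] at h
    refine h.congr' ?_
    filter_upwards [eventually_ne_atTop 0] with μ hμ
    field_simp
    ring
  have hz : Tendsto (fun μ => (1 - ((1 - η) * (1 - 2 * μ) - afun η μ) / 2) / μ) atTop
      (𝓝 (2 * (1 - η))) := by
    have h := ((hinv.const_mul ((1 + η) / 2)).add_const (1 - η)).add (ha.div_const 2)
    rw [show (1 + η) / 2 * 0 + (1 - η) + 2 * (1 - η) / 2 = 2 * (1 - η) by ring] at h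
    refine h.congr' ?_
    filter_upwards [eventually_ne_atTop 0] with μ hμ
    field_simp
    ring
  have hztop : Tendsto (fun μ => 1 - ((1 - η) * (1 - 2 * μ) - afun η μ) / 2) atTop atTop := by
    refine (hz.pos_mul_atTop hA tendsto_id).congr' ?_
    filter_upwards [eventually_ne_atTop 0] with μ hμ
    simp [hμ]
  have hfirst : Tendsto (fun μ => (cfun η μ - (2 * μ - 1) * (1 - η) * afun η μ) / bfun η μ *
      arcoth (((1 - η) * (1 - 2 * μ) - afun η μ) / 2)) atTop (𝓝 2) := by
    have h := ((hdiff.div hb hA.ne').div hz hA.ne').mul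
      (tendsto_mul_arcoth_one_sub.comp hztop)
    rw [show -8 * (1 - η) ^ 2 / (2 * (1 - η)) / (2 * (1 - η)) * -1 = 2 by
      field_simp; norm_num] at h
    refine h.congr' ?_
    filter_upwards [eventually_ne_atTop 0, hztop.eventually_ne_atTop 0,
      hb.eventually_ne hA.ne'] with μ hμ hzμ hbμ
    have hb0 : bfun η μ ≠ 0 := fun h0 => hbμ (by simp [h0])
    simp only [Function.comp_apply, sub_sub_cancel, Pi.div_apply]
    generalize arcoth (((1 - η) * (1 - 2 * μ) - afun η μ) / 2) = t
    generalize 1 - ((1 - η) * (1 - 2 * μ) - afun η μ) / 2 = z at hzμ ⊢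
    field_simp
  have hx : Tendsto (fun μ => ((1 - η) * (1 - 2 * μ) + afun η μ) / 2) atTop
      (𝓝 ((1 + η) / (1 - η))) := by
    have h := (he.const_add (1 - η)).div_const 2
    rw [show (1 - η + 4 * (1 + (4 - η) * η) / (2 * (2 * (1 - η)))) / 2 = (1 + η) / (1 - η) by
      field_simp; ring] at h
    refine h.congr fun μ => ?_
    ring
  have hx₁ : (1 + η) / (1 - η) - 1 = 2 * η / (1 - η) := by field_simp; ring
  have hx₂ : (1 + η) / (1 - η) + 1 = 2 / (1 - η) := by field_simp; ring
  have harcoth : arcoth ((1 + η) / (1 - η)) = -(1 / 2) * Real.log η := by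
    rw [arcoth, hx₁, hx₂, show 2 / (1 - η) / (2 * η / (1 - η)) = η⁻¹ by field_simp, Real.log_inv]
    ring
  have hsecond : Tendsto (fun μ => (cfun η μ + (2 * μ - 1) * (1 - η) * afun η μ) / bfun η μ *
      arcoth (((1 - η) * (1 - 2 * μ) + afun η μ) / 2)) atTop (𝓝 (Real.log η)) := by
    have hcont : ContinuousAt arcoth ((1 + η) / (1 - η)) :=
      continuousAt_arcoth (by rw [hx₁]; positivity) (by rw [hx₂]; positivity)
    have h := (hsum.div hb hA.ne').mul (hcont.tendsto.comp hx)
    rw [harcoth, show -4 * (1 - η) / (2 * (1 - η)) * (-(1 / 2) * Real.log η) = Real.log η by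
      field_simp; norm_num] at h
    refine h.congr' ?_
    filter_upwards [eventually_ne_atTop 0] with μ hμ
    simp only [Function.comp_apply, Pi.div_apply]
    rw [div_div_div_cancel_right₀ hμ]
  exact hfirst.sub hsecond
end

section
/- For every η with 0 < η < 1, S^μ := log₂((μ − 1/2) * Real.sqrt η) − s((1 − η)*μ + η/2) + Δ(μ)/(2 * Real.log 2) tends to −log₂(1 − η) as μ → ∞ (limit along Filter.atTop). (S^μ is the relative entropy S(ρ_E^μ ‖ σ̃_s^μ) between the quasi-Choi matrix of the lossy channel of transmissivity η and the closest-correlated separable Gaussian state; this limit shows that the relative-entropy-of-entanglement upper bound on the two-way capacities of the lossy channel equals −log₂(1 − η), matching the reverse-coherent-information lower bound and thereby establishing Q₂(η) = D₂(η) = K(η) = −log₂(1 − η).) -/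
open Filter Topology

lemma sqrt_eq_mul_sqrt {x r s : ℝ} (hx : 0 < x) (h : r = x ^ 2 * s) :
    Real.sqrt r = x * Real.sqrt s := by
  rw [h, Real.sqrt_mul (sq_nonneg x), Real.sqrt_sq hx.le]

/-- First-order expansion of a square root at infinity. -/
lemma tendsto_mul_sqrt_sub {d α β : ℝ} (hd : 0 < d) (hα : 0 ≤ α) (hβ : 0 ≤ β) :
    Tendsto (fun x : ℝ => x * (Real.sqrt (d ^ 2 + α * x⁻¹ + β * x⁻¹ ^ 2) - d)) atTop
      (𝓝 (α / (2 * d))) := by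
  have hi : Tendsto (fun x : ℝ => x⁻¹) atTop (𝓝 0) := tendsto_inv_atTop_zero
  have hc : Tendsto (fun u : ℝ => (α + β * u) / (Real.sqrt (d ^ 2 + α * u + β * u ^ 2) + d))
      (𝓝 0) (𝓝 (α / (2 * d))) := by
    have h : ContinuousAt
        (fun u : ℝ => (α + β * u) / (Real.sqrt (d ^ 2 + α * u + β * u ^ 2) + d)) 0 := by
      refine ContinuousAt.div (by fun_prop) (by fun_prop) (by positivity)
    convert h.tendsto using 2
    simp [Real.sqrt_sq hd.le]
    ring
  refine (hc.comp hi).congr' ?_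
  filter_upwards [eventually_gt_atTop 0] with x hx
  have hs := Real.sq_sqrt (show 0 ≤ d ^ 2 + α * x⁻¹ + β * x⁻¹ ^ 2 by positivity)
  simp only [Function.comp]
  set r := Real.sqrt (d ^ 2 + α * x⁻¹ + β * x⁻¹ ^ 2)
  have hr : 0 < r + d := by positivity
  rw [div_eq_iff hr.ne']
  have : x * (r - d) * (r + d) = x * (r ^ 2 - d ^ 2) := by ring
  rw [this, hs]
  field_simp
  ring

lemma tendsto_of_tendsto_mul_sub {f : ℝ → ℝ} {d l : ℝ}
    (h : Tendsto (fun x : ℝ => x * (f x - d)) atTop (𝓝 l)) : Tendsto f atTop (𝓝 d) := by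
  have h1 := (tendsto_inv_atTop_zero.mul h).add_const d
  rw [zero_mul, zero_add] at h1
  refine h1.congr' ?_
  filter_upwards [eventually_gt_atTop 0] with x hx
  field_simp
  ring

lemma tendsto_mul_arcoth {g : ℝ → ℝ} {l : ℝ} (hl : l ≠ 0)
    (hg : Tendsto g atTop (𝓝 l)) :
    Tendsto (fun x : ℝ => x * arcoth (x * g x)) atTop (𝓝 l⁻¹) := by
  have hi : Tendsto (fun x : ℝ => x⁻¹) atTop (𝓝 0) := tendsto_inv_atTop_zero
  have hden : Tendsto (fun x : ℝ => g x - x⁻¹) atTop (𝓝 l) := by simpa using hg.sub hi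
  have hne : ∀ᶠ x : ℝ in atTop, x * g x - 1 ≠ 0 := by
    filter_upwards [hden.eventually_ne hl, eventually_gt_atTop 0] with x h hx h0
    apply h
    field_simp
    linarith
  have h1 : Tendsto (fun x : ℝ => x * (2 / (x * g x - 1))) atTop (𝓝 (2 / l)) := by
    refine (tendsto_const_nhds.div hden hl).congr' ?_
    filter_upwards [hden.eventually_ne hl, hne, eventually_gt_atTop 0] with x h h' hx
    simp only [Pi.div_apply]
    rw [div_eq_iff h]
    field_simp
  have h2 := (Real.tendsto_mul_log_one_add_of_tendsto h1).const_mul (1 / 2)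
  have h3 : 1 / 2 * (2 / l) = l⁻¹ := by field_simp
  rw [h3] at h2
  refine h2.congr' ?_
  filter_upwards [hne] with x h
  have : 1 + 2 / (x * g x - 1) = (x * g x + 1) / (x * g x - 1) := by
    field_simp
    ring
  rw [this, arcoth]
  ring

lemma tendsto_Δfun {η : ℝ} (hη0 : 0 < η) (hη1 : η < 1) :
    Tendsto (fun x : ℝ => Δfun η ((x + 1) / 2)) atTop (𝓝 (2 - Real.log η)) := by
  have hτ : 0 < 1 - η := by linarith
  set A : ℝ → ℝ := fun x => Real.sqrt ((1 - η) ^ 2 + 4 * (1 + η) * x⁻¹ + 4 * x⁻¹ ^ 2)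
  set R : ℝ → ℝ := fun x => Real.sqrt (1 ^ 2 + 2 * x⁻¹ + 0 * x⁻¹ ^ 2)
  have hA1 : Tendsto (fun x => x * (A x - (1 - η))) atTop
      (𝓝 (4 * (1 + η) / (2 * (1 - η)))) :=
    tendsto_mul_sqrt_sub hτ (by positivity) (by norm_num)
  have hR1 : Tendsto (fun x => x * (R x - 1)) atTop (𝓝 (2 / (2 * 1))) :=
    tendsto_mul_sqrt_sub one_pos (by norm_num) le_rfl
  have hA0 : Tendsto A atTop (𝓝 (1 - η)) := tendsto_of_tendsto_mul_sub hA1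
  have hi : Tendsto (fun x : ℝ => x⁻¹) atTop (𝓝 0) := tendsto_inv_atTop_zero
  -- `cfun` rescaled by `x ^ 2`
  set C : ℝ → ℝ := fun x =>
    4 * η * (R x - 1) - (1 - η) ^ 2 - 4 * (1 + η) * x⁻¹ - 4 * x⁻¹ ^ 2 with hC
  have hC1 : Tendsto (fun x => x * (C x + (1 - η) * A x)) atTop (𝓝 (-2 * (1 - η))) := by
    have h := (((hR1.const_mul (4 * η)).add (hA1.const_mul (1 - η))).sub_const
      (4 * (1 + η))).sub (hi.const_mul 4)
    have e : 4 * η * (2 / (2 * 1)) + (1 - η) * (4 * (1 + η) / (2 * (1 - η))) - 4 * (1 + η)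
        - 4 * 0 = -2 * (1 - η) := by
      field_simp
      ring
    rw [e] at h
    refine h.congr' ?_
    filter_upwards [eventually_gt_atTop 0] with x hx
    simp only [hC]
    field_simp
    ring
  have hC0 : Tendsto C atTop (𝓝 (-(1 - η) ^ 2)) := by
    have h := ((((tendsto_of_tendsto_mul_sub hR1).sub_const 1).const_mul (4 * η)).sub_const
      ((1 - η) ^ 2)).sub (hi.const_mul (4 * (1 + η))) |>.sub ((hi.pow 2).const_mul 4)
    convert h using 2
    ring
  have hp : Tendsto (fun x => x * arcoth (x * (-(1 - η) - A x) * 2⁻¹)) atTop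
      (𝓝 (-(1 - η))⁻¹) := by
    have h : Tendsto (fun x => (-(1 - η) - A x) * 2⁻¹) atTop (𝓝 (-(1 - η))) := by
      convert (tendsto_const_nhds (x := -(1 - η))).sub hA0 |>.mul_const (2⁻¹ : ℝ) using 2
      ring
    simpa only [mul_assoc] using tendsto_mul_arcoth (by linarith) h
  have hq : Tendsto (fun x => arcoth (x * (A x - (1 - η)) * 2⁻¹)) atTop
      (𝓝 (-(1 / 2) * Real.log η)) := by
    have h := hA1.mul_const (2⁻¹ : ℝ)
    have e1 : 4 * (1 + η) / (2 * (1 - η)) * 2⁻¹ - 1 = 2 * η / (1 - η) := by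
      field_simp
      ring
    have e2 : 4 * (1 + η) / (2 * (1 - η)) * 2⁻¹ + 1 = 2 / (1 - η) := by
      field_simp
      ring
    have hn := h.add_const 1
    have hd := h.sub_const 1
    rw [e2] at hn
    rw [e1] at hd
    have hquot := hn.div hd (by positivity)
    have e3 : 2 / (1 - η) / (2 * η / (1 - η)) = η⁻¹ := by
      field_simp
    rw [e3] at hquot
    have hl := ((Real.continuousAt_log (inv_ne_zero hη0.ne')).tendsto.comp hquot).const_mul
      (1 / 2)
    rw [Real.log_inv] at hl
    rw [mul_neg, ← neg_mul] at hl
    exact hl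
  have main := (((hC0.sub (hA0.const_mul (1 - η))).div hA0 hτ.ne').mul hp).sub
    ((hC1.div hA0 hτ.ne').mul hq)
  have e : (-(1 - η) ^ 2 - (1 - η) * (1 - η)) / (1 - η) * (-(1 - η))⁻¹
      - -2 * (1 - η) / (1 - η) * (-(1 / 2) * Real.log η) = 2 - Real.log η := by
    rw [inv_neg]
    field_simp
    ring
  rw [e] at main
  refine main.congr' ?_
  filter_upwards [eventually_gt_atTop 0] with x hx
  have ha : afun η ((x + 1) / 2) = x * A x := sqrt_eq_mul_sqrt hx (by field_simp; ring)
  have hb : bfun η ((x + 1) / 2) = x * A x := sqrt_eq_mul_sqrt hx (by field_simp; ring)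
  have hr : Real.sqrt (4 * ((x + 1) / 2) ^ 2 - 1) = x * R x :=
    sqrt_eq_mul_sqrt hx (by field_simp; ring)
  have hc : cfun η ((x + 1) / 2) = x ^ 2 * C x := by
    rw [cfun, hr]
    simp only [hC]
    field_simp
    ring
  have hApos : 0 < A x := Real.sqrt_pos.2 (by positivity)
  have e1 : ((1 - η) * (1 - 2 * ((x + 1) / 2)) - x * A x) / 2
      = x * (-(1 - η) - A x) * 2⁻¹ := by ring
  have e2 : ((1 - η) * (1 - 2 * ((x + 1) / 2)) + x * A x) / 2
      = x * (A x - (1 - η)) * 2⁻¹ := by ring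
  rw [Δfun, ha, hb, hc, e1, e2]
  simp only [Pi.div_apply]
  field_simp
  ring

lemma tendsto_sfun_sub_log2 :
    Tendsto (fun t : ℝ => sfun (t + 1 / 2) - log2 t) atTop (𝓝 (1 / Real.log 2)) := by
  have hi : Tendsto (fun t : ℝ => 1 / t) atTop (𝓝 0) := by
    simpa using tendsto_inv_atTop_zero (𝕜 := ℝ)
  have h1 : Tendsto (fun t : ℝ => t * Real.log (1 + 1 / t)) atTop (𝓝 1) :=
    Real.tendsto_mul_log_one_add_div_atTop 1
  have h2 : Tendsto (fun t : ℝ => Real.log (1 + 1 / t)) atTop (𝓝 0) := by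
    have h := (Real.continuousAt_log (x := 1 + 0) (by norm_num)).tendsto.comp (hi.const_add 1)
    simpa [Function.comp_def] using h
  have h := (h1.add h2).div_const (Real.log 2)
  rw [add_zero] at h
  refine h.congr' ?_
  filter_upwards [eventually_gt_atTop 0] with t ht
  have e : 1 + 1 / t = (t + 1) / t := by
    field_simp
  rw [e, Real.log_div (by positivity) ht.ne']
  have e1 : t + 1 / 2 + 1 / 2 = t + 1 := by ring
  have e2 : t + 1 / 2 - 1 / 2 = t := by ring
  simp only [sfun, log2, e1, e2]
  ring

theorem relative_entropy_lossy_limit (η : ℝ) (hη0 : 0 < η) (hη1 : η < 1) :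
    Filter.Tendsto
      (fun μ : ℝ =>
        log2 ((μ - 1/2) * Real.sqrt η) - sfun ((1 - η)*μ + η/2)
          + Δfun η μ / (2 * Real.log 2))
      Filter.atTop (nhds (-(log2 (1 - η)))) := by
  have hτ : 0 < 1 - η := by linarith
  have hlog2 : Real.log 2 ≠ 0 := (Real.log_pos one_lt_two).ne'
  have hx : Tendsto (fun μ : ℝ => 2 * μ - 1) atTop atTop :=
    tendsto_atTop_add_const_right _ _ (tendsto_id.const_mul_atTop two_pos)
  have ht : Tendsto (fun μ : ℝ => (1 - η) / 2 * (2 * μ - 1)) atTop atTop :=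
    hx.const_mul_atTop (by positivity)
  have h := (((tendsto_Δfun hη0 hη1).comp hx).div_const (2 * Real.log 2)).sub
    (tendsto_sfun_sub_log2.comp ht) |>.add_const
    ((Real.log η / 2 - Real.log (1 - η)) / Real.log 2)
  have e : (2 - Real.log η) / (2 * Real.log 2) - 1 / Real.log 2
      + (Real.log η / 2 - Real.log (1 - η)) / Real.log 2 = -(log2 (1 - η)) := by
    rw [log2]
    field_simp
    ring
  rw [e] at h
  refine h.congr' ?_
  filter_upwards [eventually_gt_atTop 1] with μ hμ
  have hm : 0 < μ - 1 / 2 := by linarith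
  have e1 : (2 * μ - 1 + 1) / 2 = μ := by ring
  have e2 : (1 - η) / 2 * (2 * μ - 1) = (1 - η) * (μ - 1 / 2) := by ring
  have e3 : (1 - η) * (μ - 1 / 2) + 1 / 2 = (1 - η) * μ + η / 2 := by ring
  simp only [Function.comp, e1, e2, e3, log2]
  rw [Real.log_mul hτ.ne' hm.ne', Real.log_mul hm.ne' (Real.sqrt_ne_zero'.2 hη0),
    Real.log_sqrt hη0.le]
  ring
end

section
/- Fix η with 0 < η < 1 and a real n̄ ≥ 0, and set ω := n̄ + 1/2. Then, as μ → ∞ (along Filter.atTop), the expression (2*(1 − 2*ω*arcoth((1 + η)/(η − 1))))/(2 * Real.log 2) − (h(n̄) + log₂(Real.exp 1 * (1 − η) * μ)) + (1/2) * log₂((2*μ − 1)*(2*ω − 1 + 2*η*(μ − ω))/4) tends to −log₂((1 − η) * η^n̄) − h(n̄) (with η^n̄ the real power Real.rpow). (Combining the asymptotics of the three pieces of the Gaussian relative entropy S(ρ_E^μ ‖ σ̃_s^μ) for the thermal-loss channel with transmissivity η and thermal number n̄, this limit computes the paper's entanglement-flux upper bound Φ(η, n̄) = −log₂[(1 − η)η^{n̄}]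 − h(n̄) on the two-way capacities of the thermal-loss channel, valid for n̄ < η/(1 − η).) -/
/-- The value of `arcoth` behind the thermal-loss channel. -/
theorem arcoth_one_add_div_sub_one {η : ℝ} (hη : η ≠ 1) :
    arcoth ((1 + η) / (η - 1)) = 1 / 2 * Real.log η := by
  have h : η - 1 ≠ 0 := sub_ne_zero.mpr hη
  have h1 : (1 + η) / (η - 1) + 1 = 2 * η / (η - 1) := by field_simp; ring
  have h2 : (1 + η) / (η - 1) - 1 = 2 / (η - 1) := by field_simp; ring
  rw [arcoth, h1, h2, div_div_div_cancel_right₀ h, mul_div_cancel_left₀ η two_ne_zero]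

theorem entanglement_flux_thermal_loss_limit (η nbar : ℝ)
    (hη0 : 0 < η) (hη1 : η < 1) (hn : 0 ≤ nbar) :
    Filter.Tendsto
      (fun μ : ℝ =>
        (2*(1 - 2*(nbar + 1/2)*arcoth ((1 + η)/(η - 1))))/(2 * Real.log 2)
          - (hfun nbar + log2 (Real.exp 1 * (1 - η) * μ))
          + (1/2) * log2 ((2*μ - 1)*(2*(nbar + 1/2) - 1 + 2*η*(μ - (nbar + 1/2)))/4))
      Filter.atTop
      (nhds (-(log2 ((1 - η) * η ^ nbar)) - hfun nbar)) := by
  have hlog2 : Real.log 2 ≠ 0 := (Real.log_pos one_lt_two).ne'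
  have hη' : 1 - η ≠ 0 := (sub_pos.mpr hη1).ne'
  set c : ℝ := 2 * nbar - η * (2 * nbar + 1) with hc
  have hinv : Filter.Tendsto (fun μ : ℝ => μ⁻¹) Filter.atTop (nhds 0) := tendsto_inv_atTop_zero
  have hg : Filter.Tendsto (fun μ : ℝ => (2 - μ⁻¹) * (2 * η + c * μ⁻¹) / 4) Filter.atTop
      (nhds η) := by
    have h := ((hinv.const_sub 2).mul ((hinv.const_mul c).const_add (2 * η))).div_const 4
    convert h using 2
    ring
  have hlim := ((hg.log hη0.ne').div_const (2 * Real.log 2)).const_add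
    ((-(nbar + 1 / 2) * Real.log η - Real.log (1 - η)) / Real.log 2 - hfun nbar)
  have hvalue : (-(nbar + 1 / 2) * Real.log η - Real.log (1 - η)) / Real.log 2 - hfun nbar
      + Real.log η / (2 * Real.log 2) = -(log2 ((1 - η) * η ^ nbar)) - hfun nbar := by
    rw [log2, Real.log_mul hη' (Real.rpow_pos_of_pos hη0 _).ne', Real.log_rpow hη0]
    field_simp
    ring
  rw [hvalue] at hlim
  refine hlim.congr' ?_
  filter_upwards [Filter.eventually_gt_atTop 0, hg.eventually_ne hη0.ne'] with μ hμ hgμ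
  have hfactor : (2*μ - 1)*(2*(nbar + 1/2) - 1 + 2*η*(μ - (nbar + 1/2)))/4
      = μ ^ 2 * ((2 - μ⁻¹) * (2 * η + c * μ⁻¹) / 4) := by
    rw [hc]
    field_simp
    ring
  rw [arcoth_one_add_div_sub_one hη1.ne, hfactor, log2, log2,
    Real.log_mul (mul_ne_zero (Real.exp_ne_zero 1) hη') hμ.ne',
    Real.log_mul (Real.exp_ne_zero 1) hη', Real.log_exp,
    Real.log_mul (pow_ne_zero 2 hμ.ne') hgμ, Real.log_pow]
  generalize Real.log ((2 - μ⁻¹) * (2 * η + c * μ⁻¹) / 4) = L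
  push_cast
  field_simp
  ring
end

section
/- For every η with 0 < η ≤ 1, (2*η*log₂ π + (2*η − 3)*log₂(3 − 2*η) + 3*log₂ 3)/(2*η) ≤ log₂(3 * π * Real.exp 1). (The left-hand side is the classical-communication cost γ_CC(η), in classical bits per channel use, of the optimal reverse-reconciliation key-generation protocol achieving the secret-key capacity of the lossy channel with transmissivity η; the inequality states that this cost never exceeds log₂(3πe) ≈ 4.68 bits per use.) -/
theorem cc_cost_bound (η : ℝ) (hη0 : 0 < η) (hη1 : η ≤ 1) :
    (2*η*log2 Real.pi + (2*η - 3)*log2 (3 - 2*η) + 3*log2 3)/(2*η)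
      ≤ log2 (3 * Real.pi * Real.exp 1) := by
  have ha : 0 < 3 - 2 * η := by linarith
  have hl : 0 < Real.log 2 := Real.log_pos one_lt_two
  have hlog : Real.log (3 * Real.pi * Real.exp 1) = Real.log 3 + Real.log Real.pi + 1 := by
    rw [Real.log_mul (by positivity) (by positivity),
      Real.log_mul (by positivity) (by positivity), Real.log_exp]
  have key : (3 - 2 * η) * (Real.log 3 - Real.log (3 - 2 * η)) ≤ 2 * η := by
    have h := Real.log_le_sub_one_of_pos (div_pos three_pos ha)
    rw [Real.log_div three_ne_zero ha.ne'] at h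
    calc _ ≤ (3 - 2 * η) * (3 / (3 - 2 * η) - 1) := mul_le_mul_of_nonneg_left h ha.le
      _ = 2 * η := by rw [mul_sub, mul_div_cancel₀ _ ha.ne']; ring
  rw [div_le_iff₀ (by positivity)]
  simp only [log2, hlog]
  rw [← sub_nonneg]
  have heq : (Real.log 3 + Real.log Real.pi + 1) / Real.log 2 * (2 * η) -
      (2 * η * (Real.log Real.pi / Real.log 2) +
        (2 * η - 3) * (Real.log (3 - 2 * η) / Real.log 2) + 3 * (Real.log 3 / Real.log 2)) =
      (2 * η - (3 - 2 * η) * (Real.log 3 - Real.log (3 - 2 * η))) / Real.log 2 := by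
    ring
  rw [heq]
  exact div_nonneg (sub_nonneg.2 key) hl.le
end

section
/- The function η ↦ (2*η*log₂ π + (2*η − 3)*log₂(3 − 2*η) + 3*log₂ 3)/(2*η) tends to log₂(3 * π * Real.exp 1) as η → 0 from the right (limit along nhdsWithin 0 (Set.Ioi 0)). (The classical-communication cost γ_CC(η) of the optimal key-generation protocol over the lossy channel attains its supremum log₂(3πe) in the high-loss limit η → 0.) -/
theorem hasDerivAt_sub_mul_log2_sub :
    HasDerivAt (fun η : ℝ => (2*η - 3)*log2 (3 - 2*η))
      (2*log2 3 + 2/Real.log 2) 0 := by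
  have h1 : HasDerivAt (fun η : ℝ => 2*η - 3) 2 0 := by
    simpa using ((hasDerivAt_id (0:ℝ)).const_mul 2).sub_const 3
  have h2 : HasDerivAt (fun η : ℝ => 3 - 2*η) (-2) 0 := by
    simpa using ((hasDerivAt_id (0:ℝ)).const_mul 2).const_sub 3
  have h3 := (h2.log (by norm_num)).div_const (Real.log 2)
  refine (h1.mul h3).congr_deriv ?_
  norm_num [log2]
  ring

theorem cc_cost_limit_high_loss :
    Filter.Tendsto
      (fun η : ℝ =>
        (2*η*log2 Real.pi + (2*η - 3)*log2 (3 - 2*η) + 3*log2 3)/(2*η))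
      (nhdsWithin 0 (Set.Ioi 0))
      (nhds (log2 (3 * Real.pi * Real.exp 1))) := by
  have hlog : log2 (3 * Real.pi * Real.exp 1)
      = log2 Real.pi + (2*log2 3 + 2/Real.log 2)/2 := by
    unfold log2
    rw [Real.log_mul (by positivity) (by positivity),
      Real.log_mul (by positivity) (by positivity), Real.log_exp]
    ring
  rw [hlog]
  refine Filter.Tendsto.congr' ?_
    ((hasDerivAt_sub_mul_log2_sub.tendsto_slope_zero_right.div_const 2).const_add
      (log2 Real.pi))
  filter_upwards [self_mem_nhdsWithin] with η hη
  have hη0 : η ≠ 0 := ne_of_gt hη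
  simp only [zero_add, mul_zero, zero_sub, sub_zero, smul_eq_mul]
  field_simp
  ring
end

section
/- For all natural numbers a, b, s, t and every matrix ρ : Matrix (Fin d) (Fin d) ℂ, U a b * (U s t * ρ * (U s t)ᴴ) * (U a b)ᴴ = U (a+s) (b+t) * ρ * (U (a+s) (b+t))ᴴ. (The conjugation maps 𝒰_g(ρ) := U_g ρ U_g† satisfy the group law 𝒰_g ∘ 𝒰_h = 𝒰_{g·h}, i.e. they form a unitary representation of the abelian group ℤ_d × ℤ_d — the phases in the Weyl composition law cancel under conjugation.) -/
open scoped BigOperators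

/-- Root of unity `ω = exp(2πi/d)`. -/
noncomputable def omega (d : ℕ) : ℂ := Complex.exp (2 * (Real.pi : ℂ) * Complex.I / d)

/-- Generalized Pauli shift matrix: `X|k⟩ = |k ⊕ 1⟩` (addition mod `d`). -/
def Xmat (d : ℕ) : Matrix (Fin d) (Fin d) ℂ :=
  Matrix.of fun j k => if (j : ℤ) = ((k : ℤ) + 1) % d then 1 else 0

/-- Generalized Pauli phase matrix: `Z|j⟩ = ω^j |j⟩`. -/
noncomputable def Zmat (d : ℕ) : Matrix (Fin d) (Fin d) ℂ :=
  Matrix.diagonal fun j => (omega d) ^ (j : ℕ)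

/-- Teleportation (Weyl–Heisenberg) unitaries `U_{ab} = X^a Z^b`. -/
noncomputable def Umat (d a b : ℕ) : Matrix (Fin d) (Fin d) ℂ :=
  Xmat d ^ a * Zmat d ^ b

theorem omega_pow_self {d : ℕ} (hd : d ≠ 0) : omega d ^ d = 1 :=
  (Complex.isPrimitiveRoot_exp d hd).pow_eq_one

theorem omega_mul_star_self {d : ℕ} (hd : d ≠ 0) : omega d * star (omega d) = 1 := by
  have hnorm : ‖omega d‖ = 1 := Complex.norm_eq_one_of_pow_eq_one (omega_pow_self hd) hd
  rw [Complex.star_def, Complex.mul_conj, Complex.normSq_eq_norm_sq, hnorm]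
  norm_num

theorem Zmat_mul_Xmat {d : ℕ} (hd : d ≠ 0) :
    Zmat d * Xmat d = omega d • (Xmat d * Zmat d) := by
  ext j k
  simp only [Zmat, Xmat, Matrix.diagonal_mul, Matrix.smul_apply, Matrix.mul_diagonal,
    Matrix.of_apply, smul_eq_mul]
  split_ifs with h
  · have hj : (j : ℕ) = (k + 1) % d := by exact_mod_cast h
    rw [hj, ← pow_eq_pow_mod _ (omega_pow_self hd), pow_succ']
    ring
  · simp

theorem Zmat_mul_Xmat_pow {d : ℕ} (hd : d ≠ 0) (s : ℕ) :
    Zmat d * Xmat d ^ s = omega d ^ s • (Xmat d ^ s * Zmat d) := by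
  induction s with
  | zero => simp
  | succ s ih =>
    rw [pow_succ, ← mul_assoc, ih, smul_mul_assoc, mul_assoc, Zmat_mul_Xmat hd,
      mul_smul_comm, smul_smul, ← mul_assoc, ← pow_succ, ← pow_succ]

theorem Zmat_pow_mul_Xmat_pow {d : ℕ} (hd : d ≠ 0) (b s : ℕ) :
    Zmat d ^ b * Xmat d ^ s = omega d ^ (s * b) • (Xmat d ^ s * Zmat d ^ b) := by
  induction b with
  | zero => simp
  | succ b ih =>
    rw [pow_succ, mul_assoc, Zmat_mul_Xmat_pow hd, mul_smul_comm, ← mul_assoc, ih,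
      smul_mul_assoc, smul_smul, mul_assoc, ← pow_add, Nat.mul_succ, add_comm s]

/-- The Weyl composition law. -/
theorem Umat_mul_Umat {d : ℕ} (hd : d ≠ 0) (a b s t : ℕ) :
    Umat d a b * Umat d s t = omega d ^ (s * b) • Umat d (a + s) (b + t) := by
  calc Umat d a b * Umat d s t
      = Xmat d ^ a * (Zmat d ^ b * Xmat d ^ s) * Zmat d ^ t := by
        simp only [Umat, mul_assoc]
    _ = omega d ^ (s * b) • Umat d (a + s) (b + t) := by
        rw [Zmat_pow_mul_Xmat_pow hd]
        simp only [Umat, pow_add, mul_smul_comm, smul_mul_assoc, mul_assoc]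

open Matrix in
theorem weyl_conjugation_group_law (d : ℕ) (hd : 1 ≤ d) (a b s t : ℕ)
    (ρ : Matrix (Fin d) (Fin d) ℂ) :
    Umat d a b * (Umat d s t * ρ * (Umat d s t)ᴴ) * (Umat d a b)ᴴ
      = Umat d (a+s) (b+t) * ρ * (Umat d (a+s) (b+t))ᴴ := by
  have hd' : d ≠ 0 := Nat.one_le_iff_ne_zero.mp hd
  calc Umat d a b * (Umat d s t * ρ * (Umat d s t)ᴴ) * (Umat d a b)ᴴ
      = (Umat d a b * Umat d s t) * ρ * (Umat d a b * Umat d s t)ᴴ := by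
        simp only [conjTranspose_mul, mul_assoc]
    _ = (omega d * star (omega d)) ^ (s * b) •
          (Umat d (a+s) (b+t) * ρ * (Umat d (a+s) (b+t))ᴴ) := by
        rw [Umat_mul_Umat hd', conjTranspose_smul, mul_smul_comm, smul_mul_assoc,
          smul_mul_assoc, smul_smul, star_pow, mul_pow, mul_comm (star _ ^ _)]
    _ = Umat d (a+s) (b+t) * ρ * (Umat d (a+s) (b+t))ᴴ := by
        rw [omega_mul_star_self hd', one_pow, one_smul]
end

section
/- For all natural numbers a, b, s, t with a, b, s, t < d, Matrix.trace ((X^a * Z^b)ᴴ * (X^s * Z^t)) = if a = s ∧ b = t then (d : ℂ) else 0. (The d² teleportation unitaries U_{ab} = X^a Z^b are orthogonal in the Hilbert–Schmidt inner product with norm √d; consequently the d² vectors (U_{ab} ⊗ I)|Φ⟩, with |Φ⟩ the maximally entangled state, form an orthonormal basis of ℂ^d ⊗ ℂ^d — the Bell basis onto which the d-dimensional Bell detection of the teleportation protocol projects, each outcome occurring with probability d^{−2} on a maximally entangled input.) -/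
open scoped BigOperators

theorem isPrimitiveRoot_omega {d : ℕ} (hd : d ≠ 0) : IsPrimitiveRoot (omega d) d :=
  Complex.isPrimitiveRoot_exp d hd

theorem star_omega_mul_omega {d : ℕ} (hd : d ≠ 0) : star (omega d) * omega d = 1 := by
  have h := (isPrimitiveRoot_omega hd).norm'_eq_one hd
  rw [Complex.star_def, mul_comm, Complex.mul_conj, Complex.normSq_eq_norm_sq, h]
  norm_num

theorem Xmat_apply (d : ℕ) (j k : Fin d) :
    Xmat d j k = if (j : ℕ) = (k + 1) % d then 1 else 0 := by
  simp only [Xmat, Matrix.of_apply]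
  congr 1
  norm_cast

theorem Xmat_pow_apply (d a : ℕ) (j k : Fin d) :
    (Xmat d ^ a) j k = if (j : ℕ) = (k + a) % d then 1 else 0 := by
  induction a generalizing k with
  | zero => simp [Matrix.one_apply, Fin.ext_iff, Nat.mod_eq_of_lt k.isLt]
  | succ a ih =>
    have hd : 0 < d := k.pos
    rw [pow_succ, Matrix.mul_apply,
      Finset.sum_eq_single (⟨(k + 1) % d, Nat.mod_lt _ hd⟩ : Fin d)]
    · simp [ih, Xmat_apply, Nat.add_assoc, Nat.add_comm a]
    · intro l _ hl
      rw [Xmat_apply, if_neg (fun h => hl (Fin.ext h)), mul_zero]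
    · simp

theorem Xmat_pow_mul_Zmat_pow_apply (d a b : ℕ) (j k : Fin d) :
    (Xmat d ^ a * Zmat d ^ b) j k =
      if (j : ℕ) = (k + a) % d then (omega d ^ b) ^ (k : ℕ) else 0 := by
  simp [Zmat, Matrix.diagonal_pow, Xmat_pow_apply, pow_right_comm]

theorem sum_star_omega_pow_mul {d b t : ℕ} (hb : b < d) (ht : t < d) :
    ∑ k : Fin d, star ((omega d ^ b) ^ (k : ℕ)) * (omega d ^ t) ^ (k : ℕ) =
      if b = t then (d : ℂ) else 0 := by
  have hd : d ≠ 0 := by omega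
  have hω := isPrimitiveRoot_omega hd
  have hstar (n : ℕ) : star (omega d ^ n) * omega d ^ n = 1 := by
    rw [star_pow, ← mul_pow, star_omega_mul_omega hd, one_pow]
  simp only [star_pow _ (_ : ℕ), ← mul_pow]
  split_ifs with h
  · subst h
    rw [← star_pow, hstar]
    simp
  · rw [Fin.sum_univ_eq_sum_range (fun k => (star (omega d) ^ b * omega d ^ t) ^ k)]
    have hne : star (omega d) ^ b * omega d ^ t ≠ 1 := fun h1 => by
      refine h (hω.pow_inj hb ht ?_)
      rw [← star_pow] at h1
      exact mul_left_cancel₀ (left_ne_zero_of_mul_eq_one (hstar b)) ((hstar b).trans h1.symm)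
    have hpow : (star (omega d) ^ b * omega d ^ t) ^ d = 1 := by
      rw [mul_pow, pow_right_comm, pow_right_comm (omega d), ← star_pow, hω.pow_eq_one]
      simp
    rw [geom_sum_eq hne, hpow, sub_self, zero_div]

theorem trace_conjTranspose_mul_eq_sum (d a b s t : ℕ) :
    Matrix.trace (Matrix.conjTranspose (Xmat d ^ a * Zmat d ^ b) * (Xmat d ^ s * Zmat d ^ t)) =
      ∑ k : Fin d, if (k + a) % d = (k + s) % d then
        star ((omega d ^ b) ^ (k : ℕ)) * (omega d ^ t) ^ (k : ℕ) else 0 := by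
  refine Finset.sum_congr rfl fun k _ => ?_
  rw [Matrix.diag_apply, Matrix.mul_apply,
    Finset.sum_eq_single (⟨(k + a) % d, Nat.mod_lt _ k.pos⟩ : Fin d)]
  · simp [Matrix.conjTranspose_apply, Xmat_pow_mul_Zmat_pow_apply]
  · intro j _ hj
    rw [Matrix.conjTranspose_apply, Xmat_pow_mul_Zmat_pow_apply,
      if_neg (fun h => hj (Fin.ext h)), star_zero, zero_mul]
  · simp

open Matrix in
theorem teleportation_unitaries_orthogonal (d : ℕ) (hd : 1 ≤ d) (a b s t : ℕ)
    (ha : a < d) (hb : b < d) (hs : s < d) (ht : t < d) :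
    Matrix.trace ((Xmat d ^ a * Zmat d ^ b)ᴴ * (Xmat d ^ s * Zmat d ^ t))
      = if a = s ∧ b = t then (d : ℂ) else 0 := by
  rw [trace_conjTranspose_mul_eq_sum]
  have hmod (k : ℕ) : (k + a) % d = (k + s) % d ↔ a = s :=
    ⟨fun h => (Nat.ModEq.add_left_cancel' k h).eq_of_lt_of_lt ha hs, fun h => h ▸ rfl⟩
  simp only [hmod]
  by_cases h : a = s
  · simpa [h] using sum_star_omega_pow_mul hb ht
  · simp [h]
end
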